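/- Let H be an m×n matrix over F₂ in which every column has Hamming weight strictly greater than 3, let q_j denote the Hamming weight of column j, and let H̃ be the full column reduction of H in which each column j is expanded with a permutation-embedding expansion of size q_j (the transpose of the full row reduction of Hᵀ via permutation-embedding expansions of sizes q_j). Then every nonzero codeword of C(H̃) has Hamming weight at least d(H)·min_j q_j; in particular d(H̃) ≥ d(H)·min_j q_j whenever C(H) is nonzero. -/

import Mathlib

open Matrix

/-- The `r × (r-1)` matrix `T_r` over `F₂` with `(T_r)_{j,k} = 1` iff `j = k` or
`j = k + 1`; it is the transpose of a parity-check matrix of the `[r,1,r]`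
binary repetition code. -/
def Trep (r : ℕ) : Matrix (Fin r) (Fin (r - 1)) (ZMod 2) :=
  Matrix.of fun j k => if (j : ℕ) = (k : ℕ) ∨ (j : ℕ) = (k : ℕ) + 1 then 1 else 0

/-- `f` is a row expansion of the row `h`: each column of `f` indexed by an element of the
support of `h` has Hamming weight exactly 1, and all other columns of `f` are zero. -/
def IsRowExpansion {κ : Type*} [Fintype κ] (h : κ → ZMod 2) {r : ℕ}
    (f : Matrix (Fin r) κ (ZMod 2)) : Prop :=
  ∀ j : κ, (h j ≠ 0 → hammingNorm (fun a => f a j) = 1) ∧ (h j = 0 → ∀ a, f a j = 0)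

/-- The full row reduction via expansions `f i` of sizes `r i`: rows are indexed by the
disjoint union `⨆ i, Fin (r i)` and columns by `κ ⊕ ⨆ i, Fin (r i - 1)`; the `i`-th block
of rows equals `f i` on the original columns, equals `T_{r i}` on the `i`-th block of new
columns, and is zero on all other new-column blocks. -/
def fullRowReduction {ι κ : Type*} [DecidableEq ι]
    (r : ι → ℕ) (f : ∀ i, Matrix (Fin (r i)) κ (ZMod 2)) :
    Matrix ((i : ι) × Fin (r i)) (κ ⊕ (i : ι) × Fin (r i - 1)) (ZMod 2) :=
  Matrix.of fun a b =>
    match b with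
    | Sum.inl cc => f a.1 a.2 cc
    | Sum.inr k =>
        if a.1 = k.1 ∧ ((a.2 : ℕ) = (k.2 : ℕ) ∨ (a.2 : ℕ) = (k.2 : ℕ) + 1) then 1 else 0

/-- The full column reduction via expansions `f j` (of the columns, i.e. of the rows of
the transpose) of sizes `r j`: the transpose of the full row reduction of the transpose. -/
def fullColumnReduction {ι κ : Type*} [DecidableEq κ]
    (r : κ → ℕ) (f : ∀ j, Matrix (Fin (r j)) ι (ZMod 2)) :
    Matrix (ι ⊕ (j : κ) × Fin (r j - 1)) ((j : κ) × Fin (r j)) (ZMod 2) :=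
  (fullRowReduction r f)ᵀ

/-- The minimum distance of the code `C(H)`: the least Hamming weight of a nonzero
vector in the kernel of `H`. -/
noncomputable def minDist {ι κ : Type*} [Fintype ι] [Fintype κ]
    (H : Matrix ι κ (ZMod 2)) : ℕ :=
  sInf {w | ∃ v : κ → ZMod 2, v ≠ 0 ∧ H.mulVec v = 0 ∧ hammingNorm v = w}

theorem sum_zmod_two_eq_hammingNorm {α : Type*} [Fintype α] (x : α → ZMod 2) :
    ∑ a, x a = (hammingNorm x : ZMod 2) := by
  have key : ∀ y : ZMod 2, y = if y ≠ 0 then 1 else 0 := by decide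
  rw [hammingNorm, ← Finset.sum_boole]
  exact Finset.sum_congr rfl fun a _ => key (x a)

/-- The column sums of a row expansion recover the expanded row. -/
theorem IsRowExpansion.sum_eq {κ : Type*} [Fintype κ] {h : κ → ZMod 2} {r : ℕ}
    {f : Matrix (Fin r) κ (ZMod 2)} (hf : IsRowExpansion h f) (j : κ) :
    ∑ a, f a j = h j := by
  by_cases hj : h j = 0
  · simp [(hf j).2 hj, hj]
  · have hone : ∀ y : ZMod 2, y ≠ 0 → y = 1 := by decide
    rw [sum_zmod_two_eq_hammingNorm (fun a => f a j), (hf j).1 hj, hone _ hj, Nat.cast_one]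

theorem minDist_le_hammingNorm {ι κ : Type*} [Fintype ι] [Fintype κ]
    {H : Matrix ι κ (ZMod 2)} {v : κ → ZMod 2} (hv : v ≠ 0) (hHv : H.mulVec v = 0) :
    minDist H ≤ hammingNorm v :=
  Nat.sInf_le ⟨v, hv, hHv, rfl⟩

/-- The repetition checks force adjacent copies of a bit to agree. -/
theorem copies_adjacent_eq {ι κ : Type*} [Fintype κ] [DecidableEq κ]
    {r : κ → ℕ} {f : ∀ j, Matrix (Fin (r j)) ι (ZMod 2)}
    {c : ((j : κ) × Fin (r j)) → ZMod 2} (hc : (fullColumnReduction r f).mulVec c = 0)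
    (j : κ) (k : ℕ) (hk : k + 1 < r j) :
    c ⟨j, ⟨k + 1, hk⟩⟩ = c ⟨j, ⟨k, by omega⟩⟩ := by
  have h := congrFun hc (Sum.inr ⟨j, ⟨k, by omega⟩⟩)
  simp only [mulVec, dotProduct, fullColumnReduction, fullRowReduction, transpose_apply,
    of_apply, Pi.zero_apply, Fintype.sum_sigma] at h
  rw [Finset.sum_eq_single j (fun b _ hb => by simp [hb]) (by simp)] at h
  rw [Finset.sum_eq_add (⟨k + 1, hk⟩ : Fin (r j)) ⟨k, by omega⟩ (by simp)
    (fun a _ ha => by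
      have h1 : (a : ℕ) ≠ k + 1 := fun e => ha.1 (Fin.ext e)
      have h2 : (a : ℕ) ≠ k := fun e => ha.2 (Fin.ext e)
      simp [h1, h2]) (by simp) (by simp)] at h
  have key : ∀ x y : ZMod 2, x + y = 0 → x = y := by decide
  exact key _ _ (by simpa using h)

/-- In a codeword of the full column reduction, all copies of a bit agree. -/
theorem exists_eq_of_fullColumnReduction_mulVec_eq_zero {ι κ : Type*} [Fintype κ]
    [DecidableEq κ] {r : κ → ℕ} {f : ∀ j, Matrix (Fin (r j)) ι (ZMod 2)}
    {c : ((j : κ) × Fin (r j)) → ZMod 2} (hc : (fullColumnReduction r f).mulVec c = 0) :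
    ∃ v : κ → ZMod 2, ∀ j a, c ⟨j, a⟩ = v j := by
  refine ⟨fun j => if h : 0 < r j then c ⟨j, ⟨0, h⟩⟩ else 0, fun j a => ?_⟩
  have key : ∀ (k : ℕ) (hk : k < r j), c ⟨j, ⟨k, hk⟩⟩ = c ⟨j, ⟨0, by omega⟩⟩ := by
    intro k
    induction k with
    | zero => intro _; rfl
    | succ k ih => intro hk; rw [copies_adjacent_eq hc, ih]
  simp only [dif_pos a.pos]
  exact key a a.2

/-- The common values of the copies in a codeword of the full column reduction form a
codeword of the original code. -/
theorem mulVec_eq_zero_of_fullColumnReduction {ι κ : Type*} [Fintype ι] [Fintype κ]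
    [DecidableEq κ] {H : Matrix ι κ (ZMod 2)} {r : κ → ℕ}
    {f : ∀ j, Matrix (Fin (r j)) ι (ZMod 2)}
    (hf : ∀ j, IsRowExpansion (fun a => H a j) (f j))
    {c : ((j : κ) × Fin (r j)) → ZMod 2} (hc : (fullColumnReduction r f).mulVec c = 0)
    {v : κ → ZMod 2} (hv : ∀ j a, c ⟨j, a⟩ = v j) : H.mulVec v = 0 := by
  funext i
  have h := congrFun hc (Sum.inl i)
  simp only [mulVec, dotProduct, fullColumnReduction, fullRowReduction, transpose_apply,
    of_apply, Pi.zero_apply, Fintype.sum_sigma, hv, ← Finset.sum_mul] at h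
  simp only [(hf _).sum_eq i] at h
  exact h

/-- Repeating the `j`-th bit `r j` times, with every `r j` at least `q`, multiplies the
Hamming weight by at least `q`. -/
theorem hammingNorm_mul_le_of_copies {κ : Type*} [Fintype κ] {r : κ → ℕ} {q : ℕ}
    (hq : ∀ j, q ≤ r j) {c : ((j : κ) × Fin (r j)) → ZMod 2} {v : κ → ZMod 2}
    (hv : ∀ j a, c ⟨j, a⟩ = v j) : hammingNorm v * q ≤ hammingNorm c := by
  simp only [hammingNorm, Finset.card_filter, Fintype.sum_sigma, hv, Finset.sum_mul]
  refine Finset.sum_le_sum fun j _ => ?_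
  by_cases hj : v j = 0 <;> simp [hj, hq j]

/-- Copying each bit of a codeword gives a codeword of the full column reduction. -/
theorem fullColumnReduction_mulVec_copies {ι κ : Type*} [Fintype ι] [Fintype κ]
    [DecidableEq κ] {H : Matrix ι κ (ZMod 2)} {r : κ → ℕ}
    {f : ∀ j, Matrix (Fin (r j)) ι (ZMod 2)}
    (hf : ∀ j, IsRowExpansion (fun a => H a j) (f j))
    {v : κ → ZMod 2} (hv : H.mulVec v = 0) :
    (fullColumnReduction r f).mulVec (fun x => v x.1) = 0 := by
  funext b
  simp only [mulVec, dotProduct, fullColumnReduction, fullRowReduction, transpose_apply,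
    of_apply, Pi.zero_apply, Fintype.sum_sigma, ← Finset.sum_mul]
  rcases b with i | ⟨j, k⟩
  · simp only [(hf _).sum_eq i]
    exact congrFun hv i
  · have hk := k.2
    rw [Finset.sum_eq_single j (fun b _ hb => by simp [hb]) (by simp)]
    rw [Finset.sum_eq_add (⟨k + 1, by omega⟩ : Fin (r j)) ⟨k, by omega⟩ (by simp)
      (fun a _ ha => by
        have h1 : (a : ℕ) ≠ k + 1 := fun e => ha.1 (Fin.ext e)
        have h2 : (a : ℕ) ≠ k := fun e => ha.2 (Fin.ext e)
        simp [h1, h2]) (by simp) (by simp)]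
    simp [CharTwo.add_self_eq_zero]

/-- If every column of `H` has weight `q j > 3`, then for the full column reduction `H̃`
with permutation-embedding expansions of sizes `q j`, every nonzero codeword of `C(H̃)`
has Hamming weight at least `d(H) · min_j q j`; in particular
`d(H̃) ≥ d(H) · min_j q j` whenever `C(H)` is nonzero. -/
theorem stmt5 {m n : ℕ}
    (H : Matrix (Fin m) (Fin n) (ZMod 2))
    (hq : ∀ j : Fin n, 3 < hammingNorm (fun a => H a j))
    (r : Fin n → ℕ) (hr : ∀ j, r j = hammingNorm (fun a => H a j))
    (f : ∀ j, Matrix (Fin (r j)) (Fin m) (ZMod 2))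
    (hf : ∀ j, IsRowExpansion (fun a => H a j) (f j))
    (hunit : ∀ j a, hammingNorm (f j a) = 1) :
    (∀ c : ((j : Fin n) × Fin (r j)) → ZMod 2, c ≠ 0 →
        (fullColumnReduction r f).mulVec c = 0 →
        minDist H * sInf (Set.range fun j : Fin n => hammingNorm (fun a => H a j))
          ≤ hammingNorm c) ∧
    ((∃ v : Fin n → ZMod 2, v ≠ 0 ∧ H.mulVec v = 0) →
        minDist H * sInf (Set.range fun j : Fin n => hammingNorm (fun a => H a j))
          ≤ minDist (fullColumnReduction r f)) := by
  have bound : ∀ c : ((j : Fin n) × Fin (r j)) → ZMod 2, c ≠ 0 →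
      (fullColumnReduction r f).mulVec c = 0 →
      minDist H * sInf (Set.range fun j : Fin n => hammingNorm (fun a => H a j))
        ≤ hammingNorm c := by
    intro c hc0 hc
    obtain ⟨v, hv⟩ := exists_eq_of_fullColumnReduction_mulVec_eq_zero hc
    have hv0 : v ≠ 0 := by
      rintro rfl
      exact hc0 (funext fun x => hv x.1 x.2)
    calc _ ≤ hammingNorm v * _ := Nat.mul_le_mul_right _
          (minDist_le_hammingNorm hv0 (mulVec_eq_zero_of_fullColumnReduction hf hc hv))
      _ ≤ hammingNorm c := hammingNorm_mul_le_of_copies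
          (fun j => by rw [hr j]; exact Nat.sInf_le ⟨j, rfl⟩) hv
  refine ⟨bound, ?_⟩
  rintro ⟨v, hv0, hv⟩
  refine le_csInf ⟨_, fun x => v x.1, ?_, ?_, rfl⟩ ?_
  · obtain ⟨j, hj⟩ := Function.ne_iff.mp hv0
    exact Function.ne_iff.mpr ⟨⟨j, ⟨0, by have := hq j; have := hr j; omega⟩⟩, hj⟩
  · exact fullColumnReduction_mulVec_copies hf hv
  · rintro w ⟨c, hc0, hc, rfl⟩
    exact bound c hc0 hc
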